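/- There does not exist a 4-dimensional linear subspace M of the space of skew-symmetric 8×8 complex matrices such that every nonzero matrix in M has rank 6. -/

import Mathlib

open Matrix

section Pfaffian

variable {R : Type*} [CommRing R]

/-- The `4 × 4` Pfaffian on the listed indices. -/
def pf4 (A : Matrix (Fin 8) (Fin 8) R) (a b c d : Fin 8) : R :=
  A a b * A c d - A a c * A b d + A a d * A b c

/-- The `6 × 6` Pfaffian on the listed indices. -/
def pf6 (A : Matrix (Fin 8) (Fin 8) R) (a b c d e f : Fin 8) : R :=
  A a b * pf4 A c d e f - A a c * pf4 A b d e f + A a d * pf4 A b c e f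
    - A a e * pf4 A b c d f + A a f * pf4 A b c d e

/-- The `8 × 8` Pfaffian. -/
def pf8 (A : Matrix (Fin 8) (Fin 8) R) : R :=
  A 0 1 * pf6 A 2 3 4 5 6 7 - A 0 2 * pf6 A 1 3 4 5 6 7 + A 0 3 * pf6 A 1 2 4 5 6 7 - A 0 4 * pf6 A 1 2 3 5 6 7 + A 0 5 * pf6 A 1 2 3 4 6 7 - A 0 6 * pf6 A 1 2 3 4 5 7 + A 0 7 * pf6 A 1 2 3 4 5 6

/-- The Pfaffian adjugate. -/
def pfAdj (A : Matrix (Fin 8) (Fin 8) R) : Matrix (Fin 8) (Fin 8) R :=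
  !![0, -pf6 A 2 3 4 5 6 7, pf6 A 1 3 4 5 6 7, -pf6 A 1 2 4 5 6 7, pf6 A 1 2 3 5 6 7, -pf6 A 1 2 3 4 6 7, pf6 A 1 2 3 4 5 7, -pf6 A 1 2 3 4 5 6;
    pf6 A 2 3 4 5 6 7, 0, -pf6 A 0 3 4 5 6 7, pf6 A 0 2 4 5 6 7, -pf6 A 0 2 3 5 6 7, pf6 A 0 2 3 4 6 7, -pf6 A 0 2 3 4 5 7, pf6 A 0 2 3 4 5 6;
    -pf6 A 1 3 4 5 6 7, pf6 A 0 3 4 5 6 7, 0, -pf6 A 0 1 4 5 6 7, pf6 A 0 1 3 5 6 7, -pf6 A 0 1 3 4 6 7, pf6 A 0 1 3 4 5 7, -pf6 A 0 1 3 4 5 6;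
    pf6 A 1 2 4 5 6 7, -pf6 A 0 2 4 5 6 7, pf6 A 0 1 4 5 6 7, 0, -pf6 A 0 1 2 5 6 7, pf6 A 0 1 2 4 6 7, -pf6 A 0 1 2 4 5 7, pf6 A 0 1 2 4 5 6;
    -pf6 A 1 2 3 5 6 7, pf6 A 0 2 3 5 6 7, -pf6 A 0 1 3 5 6 7, pf6 A 0 1 2 5 6 7, 0, -pf6 A 0 1 2 3 6 7, pf6 A 0 1 2 3 5 7, -pf6 A 0 1 2 3 5 6;
    pf6 A 1 2 3 4 6 7, -pf6 A 0 2 3 4 6 7, pf6 A 0 1 3 4 6 7, -pf6 A 0 1 2 4 6 7, pf6 A 0 1 2 3 6 7, 0, -pf6 A 0 1 2 3 4 7, pf6 A 0 1 2 3 4 6;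
    -pf6 A 1 2 3 4 5 7, pf6 A 0 2 3 4 5 7, -pf6 A 0 1 3 4 5 7, pf6 A 0 1 2 4 5 7, -pf6 A 0 1 2 3 5 7, pf6 A 0 1 2 3 4 7, 0, -pf6 A 0 1 2 3 4 5;
    pf6 A 1 2 3 4 5 6, -pf6 A 0 2 3 4 5 6, pf6 A 0 1 3 4 5 6, -pf6 A 0 1 2 4 5 6, pf6 A 0 1 2 3 5 6, -pf6 A 0 1 2 3 4 6, pf6 A 0 1 2 3 4 5, 0]

/-- The elementary skew matrix. -/
def skE (i j : Fin 8) : Matrix (Fin 8) (Fin 8) R :=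
  Matrix.of fun k l => if k = i ∧ l = j then 1 else if k = j ∧ l = i then -1 else 0

set_option maxHeartbeats 8000000 in
theorem mul_pfAdj_row (A : Matrix (Fin 8) (Fin 8) R) (hs : ∀ i j, j < i → A i j = -A j i)
    (hd : ∀ i, A i i = 0) : A * pfAdj A = pf8 A • (1 : Matrix (Fin 8) (Fin 8) R) := by
  ext i j
  rw [Matrix.mul_apply, Fin.sum_univ_eight]
  have l10 := hs 1 0 (by decide)
  have l20 := hs 2 0 (by decide)
  have l21 := hs 2 1 (by decide)
  have l30 := hs 3 0 (by decide)
  have l31 := hs 3 1 (by decide)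
  have l32 := hs 3 2 (by decide)
  have l40 := hs 4 0 (by decide)
  have l41 := hs 4 1 (by decide)
  have l42 := hs 4 2 (by decide)
  have l43 := hs 4 3 (by decide)
  have l50 := hs 5 0 (by decide)
  have l51 := hs 5 1 (by decide)
  have l52 := hs 5 2 (by decide)
  have l53 := hs 5 3 (by decide)
  have l54 := hs 5 4 (by decide)
  have l60 := hs 6 0 (by decide)
  have l61 := hs 6 1 (by decide)
  have l62 := hs 6 2 (by decide)
  have l63 := hs 6 3 (by decide)
  have l64 := hs 6 4 (by decide)
  have l65 := hs 6 5 (by decide)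
  have l70 := hs 7 0 (by decide)
  have l71 := hs 7 1 (by decide)
  have l72 := hs 7 2 (by decide)
  have l73 := hs 7 3 (by decide)
  have l74 := hs 7 4 (by decide)
  have l75 := hs 7 5 (by decide)
  have l76 := hs 7 6 (by decide)
  fin_cases i <;> fin_cases j <;>
    simp [pfAdj, hd, l10, l20, l21, l30, l31, l32, l40, l41, l42, l43, l50, l51, l52, l53, l54,
      l60, l61, l62, l63, l64, l65, l70, l71, l72, l73, l74, l75, l76] <;>
    simp only [pf8, pf6, pf4] <;> ring

theorem skE_neg_transpose (i j : Fin 8) (h : i < j) : (skE i j : Matrix _ _ R)ᵀ = -skE i j := by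
  ext k l
  simp only [skE, transpose_apply, of_apply, Matrix.neg_apply]
  have := h.ne
  grind

theorem pfAdj_transpose (A : Matrix (Fin 8) (Fin 8) R) : (pfAdj A)ᵀ = -pfAdj A := by
  ext i j
  fin_cases i <;> fin_cases j <;> simp [pfAdj]

set_option maxHeartbeats 8000000 in
theorem pf8_add_skE (A : Matrix (Fin 8) (Fin 8) R) (i j : Fin 8) (h : i < j) :
    pf8 (A + skE i j) = pf8 A + pfAdj A j i := by
  fin_cases i <;> fin_cases j <;> first | (exact absurd h (by decide)) |
    (simp [pf8, pf6, pf4, pfAdj, skE]; try ring)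

theorem pf6_congr {A B : Matrix (Fin 8) (Fin 8) R} {i : Fin 8}
    (h : ∀ k l, k ≠ i → l ≠ i → A k l = B k l) (a b c d e f : Fin 8) (ha : a ≠ i) (hb : b ≠ i)
    (hc : c ≠ i) (hd : d ≠ i) (he : e ≠ i) (hf : f ≠ i) :
    pf6 A a b c d e f = pf6 B a b c d e f := by
  simp only [pf6, pf4, h a _ ha hb, h a _ ha hc, h a _ ha hd, h a _ ha he, h a _ ha hf,
    h b _ hb hc, h b _ hb hd, h b _ hb he, h b _ hb hf, h c _ hc hd, h c _ hc he, h c _ hc hf,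
    h d _ hd he, h d _ hd hf, h e _ he hf]

theorem pfAdj_congr {A B : Matrix (Fin 8) (Fin 8) R} (i k : Fin 8)
    (h : ∀ k l, k ≠ i → l ≠ i → A k l = B k l) : pfAdj A i k = pfAdj B i k := by
  fin_cases i <;> fin_cases k <;> simp [pfAdj] <;>
    exact pf6_congr h _ _ _ _ _ _ (by decide) (by decide) (by decide) (by decide) (by decide)
        (by decide)

theorem skE_mul_pfAdj (A : Matrix (Fin 8) (Fin 8) R) (i j : Fin 8) :
    skE i j * pfAdj (A + skE i j) = skE i j * pfAdj A := by
  have key : ∀ k, (pfAdj (A + skE i j) i k = pfAdj A i k) ∧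
      (pfAdj (A + skE i j) j k = pfAdj A j k) := by
    intro k
    constructor
    · apply pfAdj_congr
      intro k l hk hl
      simp [skE, hk, hl]
    · apply pfAdj_congr
      intro k l hk hl
      simp [skE, hk, hl]
  ext k l
  rw [Matrix.mul_apply, Matrix.mul_apply]
  refine Finset.sum_congr rfl fun m _ => ?_
  by_cases hm : m = i
  · rw [hm, (key l).1]
  by_cases hm' : m = j
  · rw [hm', (key l).2]
  simp [skE, hm, hm']

theorem homotopy1 (A : Matrix (Fin 8) (Fin 8) R) (hs : Aᵀ = -A)
    (hd : ∀ i, A i i = 0) (i j : Fin 8) (h : i < j) :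
    A * (pfAdj (A + skE i j) - pfAdj A) + skE i j * pfAdj A
      = pfAdj A j i • (1 : Matrix (Fin 8) (Fin 8) R) := by
  have hs' : ∀ i j, A i j = - A j i := fun i j => congrFun (congrFun hs j) i
  have h1 := mul_pfAdj_row A (fun i j _ => hs' i j) hd
  have hE : ∀ k l, (skE i j : Matrix _ _ R) k l = - skE i j l k :=
    fun k l => congrFun (congrFun (skE_neg_transpose (R := R) i j h) l) k
  have h2 := mul_pfAdj_row (A + skE i j)
    (fun k l _ => by rw [Matrix.add_apply, Matrix.add_apply, hs' k l, hE k l]; ring)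
    (fun k => by
      have := h.ne
      simp only [Matrix.add_apply, hd, skE, of_apply]
      grind)
  rw [pf8_add_skE A i j h, add_mul, skE_mul_pfAdj A i j, add_smul] at h2
  rw [mul_sub, h1]
  rw [sub_add_eq_add_sub, h2, add_sub_cancel_left]

theorem homotopy2 (A : Matrix (Fin 8) (Fin 8) R) (hs : Aᵀ = -A)
    (hd : ∀ i, A i i = 0) (i j : Fin 8) (h : i < j) :
    (pfAdj (A + skE i j) - pfAdj A) * A + pfAdj A * skE i j
      = pfAdj A j i • (1 : Matrix (Fin 8) (Fin 8) R) := by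
  have := congrArg transpose (homotopy1 A hs hd i j h)
  simpa [transpose_add, transpose_mul, transpose_sub, hs, pfAdj_transpose, skE_neg_transpose i j h,
    sub_mul, mul_sub, neg_add_eq_sub] using this

theorem map_pf6 {S : Type*} [CommRing S] (φ : R →+* S) (A : Matrix (Fin 8) (Fin 8) R)
    (a b c d e f : Fin 8) : φ (pf6 A a b c d e f) = pf6 (A.map φ) a b c d e f := by
  simp [pf6, pf4]

theorem map_pfAdj {S : Type*} [CommRing S] (φ : R →+* S) (A : Matrix (Fin 8) (Fin 8) R)
    (i j : Fin 8) : φ (pfAdj A i j) = pfAdj (A.map φ) i j := by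
  fin_cases i <;> fin_cases j <;> simp [pfAdj, map_pf6]

theorem map_pf8 {S : Type*} [CommRing S] (φ : R →+* S) (A : Matrix (Fin 8) (Fin 8) R) :
    φ (pf8 A) = pf8 (A.map φ) := by
  simp [pf8, pf6, pf4]

end Pfaffian

section RankBound

theorem sorted_cases : ∀ a b : Fin 8, a < b → ∀ c, b < c → ∀ d, c < d → ∀ e, d < e → ∀ f, e < f →
      [a, b, c, d, e, f] ∈ ([[2, 3, 4, 5, 6, 7],
        [1, 3, 4, 5, 6, 7],
        [1, 2, 4, 5, 6, 7],
        [1, 2, 3, 5, 6, 7],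
        [1, 2, 3, 4, 6, 7],
        [1, 2, 3, 4, 5, 7],
        [1, 2, 3, 4, 5, 6],
        [0, 3, 4, 5, 6, 7],
        [0, 2, 4, 5, 6, 7],
        [0, 2, 3, 5, 6, 7],
        [0, 2, 3, 4, 6, 7],
        [0, 2, 3, 4, 5, 7],
        [0, 2, 3, 4, 5, 6],
        [0, 1, 4, 5, 6, 7],
        [0, 1, 3, 5, 6, 7],
        [0, 1, 3, 4, 6, 7],
        [0, 1, 3, 4, 5, 7],
        [0, 1, 3, 4, 5, 6],
        [0, 1, 2, 5, 6, 7],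
        [0, 1, 2, 4, 6, 7],
        [0, 1, 2, 4, 5, 7],
        [0, 1, 2, 4, 5, 6],
        [0, 1, 2, 3, 6, 7],
        [0, 1, 2, 3, 5, 7],
        [0, 1, 2, 3, 5, 6],
        [0, 1, 2, 3, 4, 7],
        [0, 1, 2, 3, 4, 6],
        [0, 1, 2, 3, 4, 5]] : List (List (Fin 8))) := by
  set_option maxRecDepth 100000 in decide

theorem pf6_sorted (A : Matrix (Fin 8) (Fin 8) ℂ) (h : ∀ i j, pfAdj A i j = 0)
    (a b c d e f : Fin 8) (hab : a < b) (hbc : b < c) (hcd : c < d) (hde : d < e) (hef : e < f) :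
    pf6 A a b c d e f = 0 := by
  have hm := sorted_cases a b hab c hbc d hcd e hde f hef
  simp only [List.mem_cons, List.cons.injEq, and_true, List.not_mem_nil, or_false] at hm
  rcases hm with
    ⟨rfl, rfl, rfl, rfl, rfl, rfl⟩ | ⟨rfl, rfl, rfl, rfl, rfl, rfl⟩ | ⟨rfl, rfl, rfl, rfl, rfl, rfl⟩ | ⟨rfl, rfl, rfl, rfl, rfl, rfl⟩ | ⟨rfl, rfl, rfl, rfl, rfl, rfl⟩ | ⟨rfl, rfl, rfl, rfl, rfl, rfl⟩ | ⟨rfl, rfl, rfl, rfl, rfl, rfl⟩ | ⟨rfl, rfl, rfl, rfl, rfl, rfl⟩ | ⟨rfl, rfl, rfl, rfl, rfl, rfl⟩ | ⟨rfl, rfl, rfl, rfl, rfl, rfl⟩ | ⟨rfl, rfl, rfl, rfl, rfl, rfl⟩ | ⟨rfl, rfl, rfl, rfl, rfl, rfl⟩ | ⟨rfl, rfl, rfl, rfl, rfl, rfl⟩ | ⟨rfl, rfl, rfl, rfl, rfl, rfl⟩ | ⟨rfl, rfl, rfl, rfl, rfl, rfl⟩ | ⟨rfl, rfl, rfl, rfl,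 rfl, rfl⟩ | ⟨rfl, rfl, rfl, rfl, rfl, rfl⟩ | ⟨rfl, rfl, rfl, rfl, rfl, rfl⟩ | ⟨rfl, rfl, rfl, rfl, rfl, rfl⟩ | ⟨rfl, rfl, rfl, rfl, rfl, rfl⟩ | ⟨rfl, rfl, rfl, rfl, rfl, rfl⟩ | ⟨rfl, rfl, rfl, rfl, rfl, rfl⟩ | ⟨rfl, rfl, rfl, rfl, rfl, rfl⟩ | ⟨rfl, rfl, rfl, rfl, rfl, rfl⟩ | ⟨rfl, rfl, rfl, rfl, rfl, rfl⟩ | ⟨rfl, rfl, rfl, rfl, rfl, rfl⟩ | ⟨rfl, rfl, rfl, rfl, rfl, rfl⟩ | ⟨rfl, rfl, rfl, rfl, rfl, rfl⟩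
  · simpa [pfAdj] using h 0 1
  · simpa [pfAdj] using h 0 2
  · simpa [pfAdj] using h 0 3
  · simpa [pfAdj] using h 0 4
  · simpa [pfAdj] using h 0 5
  · simpa [pfAdj] using h 0 6
  · simpa [pfAdj] using h 0 7
  · simpa [pfAdj] using h 1 2
  · simpa [pfAdj] using h 1 3
  · simpa [pfAdj] using h 1 4
  · simpa [pfAdj] using h 1 5
  · simpa [pfAdj] using h 1 6
  · simpa [pfAdj] using h 1 7
  · simpa [pfAdj] using h 2 3
  · simpa [pfAdj] using h 2 4
  · simpa [pfAdj] using h 2 5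
  · simpa [pfAdj] using h 2 6
  · simpa [pfAdj] using h 2 7
  · simpa [pfAdj] using h 3 4
  · simpa [pfAdj] using h 3 5
  · simpa [pfAdj] using h 3 6
  · simpa [pfAdj] using h 3 7
  · simpa [pfAdj] using h 4 5
  · simpa [pfAdj] using h 4 6
  · simpa [pfAdj] using h 4 7
  · simpa [pfAdj] using h 5 6
  · simpa [pfAdj] using h 5 7
  · simpa [pfAdj] using h 6 7

theorem pf6_all (A : Matrix (Fin 8) (Fin 8) ℂ) (hs : ∀ i j, A i j = -A j i)
    (h : ∀ i j, pfAdj A i j = 0) (f : Fin 6 → Fin 8) :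
    pf6 A (f 0) (f 1) (f 2) (f 3) (f 4) (f 5) = 0 := by
  have hd : ∀ i, A i i = 0 := fun i => by
    have := hs i i
    linear_combination (1 / 2 : ℂ) * this
  have hperm : ∀ σ : Equiv.Perm (Fin 6), ∀ f : Fin 6 → Fin 8,
      pf6 A (f 0) (f 1) (f 2) (f 3) (f 4) (f 5) = 0 →
      pf6 A (f (σ 0)) (f (σ 1)) (f (σ 2)) (f (σ 3)) (f (σ 4)) (f (σ 5)) = 0 := by
    intro σ
    have hσ : σ ∈ Submonoid.closure
        (Set.range fun i : Fin 5 => Equiv.swap i.castSucc i.succ) := by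
      rw [Equiv.Perm.mclosure_swap_castSucc_succ]; trivial
    induction hσ using Submonoid.closure_induction with
    | mem x hx =>
      obtain ⟨i, rfl⟩ := hx
      intro f hf
      fin_cases i
      · change pf6 A (f 1) (f 0) (f 2) (f 3) (f 4) (f 5) = 0
        rw [← neg_eq_zero, ← hf]; simp only [pf6, pf4]; rw [hs (f 1) (f 0)]; ring
      · change pf6 A (f 0) (f 2) (f 1) (f 3) (f 4) (f 5) = 0
        rw [← neg_eq_zero, ← hf]; simp only [pf6, pf4]; rw [hs (f 2) (f 1)]; ring
      · change pf6 A (f 0) (f 1) (f 3) (f 2) (f 4) (f 5) = 0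
        rw [← neg_eq_zero, ← hf]; simp only [pf6, pf4]; rw [hs (f 3) (f 2)]; ring
      · change pf6 A (f 0) (f 1) (f 2) (f 4) (f 3) (f 5) = 0
        rw [← neg_eq_zero, ← hf]; simp only [pf6, pf4]; rw [hs (f 4) (f 3)]; ring
      · change pf6 A (f 0) (f 1) (f 2) (f 3) (f 5) (f 4) = 0
        rw [← neg_eq_zero, ← hf]; simp only [pf6, pf4]; rw [hs (f 5) (f 4)]; ring
    | one => intro f hf; exact hf
    | mul x y _ _ hx hy =>
      intro f hf
      exact hy (f ∘ x) (hx f hf)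
  have hmono : ∀ g : Fin 6 → Fin 8, Monotone g →
      pf6 A (g 0) (g 1) (g 2) (g 3) (g 4) (g 5) = 0 := by
    intro g hg
    rcases (hg (show (0 : Fin 6) ≤ 1 by decide)).eq_or_lt with h0 | h0
    · rw [h0]; simp only [pf6, pf4, hd]; ring
    rcases (hg (show (1 : Fin 6) ≤ 2 by decide)).eq_or_lt with h1 | h1
    · rw [h1]; simp only [pf6, pf4, hd]; ring
    rcases (hg (show (2 : Fin 6) ≤ 3 by decide)).eq_or_lt with h2 | h2
    · rw [h2]; simp only [pf6, pf4, hd]; ring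
    rcases (hg (show (3 : Fin 6) ≤ 4 by decide)).eq_or_lt with h3 | h3
    · rw [h3]; simp only [pf6, pf4, hd]; ring
    rcases (hg (show (4 : Fin 6) ≤ 5 by decide)).eq_or_lt with h4 | h4
    · rw [h4]; simp only [pf6, pf4, hd]; ring
    exact pf6_sorted A h _ _ _ _ _ _ h0 h1 h2 h3 h4
  have := hperm (Tuple.sort f)⁻¹ (f ∘ Tuple.sort f) (hmono _ (Tuple.monotone_sort f))
  simpa using this

theorem rank_le_four (A : Matrix (Fin 8) (Fin 8) ℂ) (hs : ∀ i j, A i j = -A j i)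
    (h : ∀ i j, pfAdj A i j = 0) : A.rank ≤ 4 := by
  have h6 := pf6_all A hs h
  by_cases h4 : ∃ a b c d, pf4 A a b c d ≠ 0
  · obtain ⟨a, b, c, d, hq⟩ := h4
    have : A = Matrix.of (fun k => ![-pf4 A b c d k / pf4 A a b c d, pf4 A a c d k / pf4 A a b c d,
        -pf4 A a b d k / pf4 A a b c d, pf4 A a b c k / pf4 A a b c d]) *
        (Matrix.of ![A a, A b, A c, A d] : Matrix (Fin 4) (Fin 8) ℂ) := by
      ext k l
      rw [Matrix.mul_apply, Fin.sum_univ_four]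
      simp only [of_apply, cons_val]
      have h6' := h6 ![a, b, c, d, k, l]
      simp only [cons_val] at h6'
      field_simp
      rw [← sub_eq_zero, ← h6']
      simp only [pf6, pf4]
      ring
    rw [this]
    exact (rank_mul_le_right _ _).trans (by simpa using rank_le_height (m := 4) _)
  push Not at h4
  by_cases h2 : ∃ a b, A a b ≠ 0
  · obtain ⟨a, b, hq⟩ := h2
    have : A = Matrix.of (fun k => ![-A b k / A a b, A a k / A a b]) *
        (Matrix.of ![A a, A b] : Matrix (Fin 2) (Fin 8) ℂ) := by
      ext k l
      rw [Matrix.mul_apply, Fin.sum_univ_two]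
      simp only [of_apply, cons_val]
      have h4' := h4 a b k l
      field_simp
      rw [← sub_eq_zero, ← h4']
      simp only [pf4]
      ring
    rw [this]
    exact (rank_mul_le_right _ _).trans ((rank_le_height (m := 2) _).trans (by norm_num))
  push Not at h2
  have : A = 0 := by ext i j; exact h2 i j
  simp [this]

end RankBound

section Graded

open MvPolynomial

theorem hc_mul {n : ℕ} {a : MvPolynomial (Fin n) ℂ} {d : ℕ} (ha : a.IsHomogeneous d)
    (w : MvPolynomial (Fin n) ℂ) (t : ℕ) :
    homogeneousComponent (t + d) (a * w) = a * homogeneousComponent t w := by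
  conv_lhs => rw [← sum_homogeneousComponent w]
  rw [Finset.mul_sum, map_sum]
  have : ∀ i, homogeneousComponent (t + d) (a * homogeneousComponent i w)
      = if i = t then a * homogeneousComponent t w else 0 := by
    intro i
    rw [homogeneousComponent_of_mem (n := d + i)
      (ha.mul (homogeneousComponent_isHomogeneous i w))]
    by_cases h : i = t
    · subst h; simp [add_comm]
    · rw [if_neg h, if_neg (by omega)]
  rw [Finset.sum_congr rfl fun i _ => this i]
  rw [Finset.sum_ite_eq']
  split_ifs with h
  · rfl
  · rw [homogeneousComponent_eq_zero, mul_zero]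
    simp at h; omega

theorem hc_mulVec {n : ℕ} {A : Matrix (Fin 8) (Fin 8) (MvPolynomial (Fin n) ℂ)} {d : ℕ}
    (hA : ∀ i j, (A i j).IsHomogeneous d) (w : Fin 8 → MvPolynomial (Fin n) ℂ) (t : ℕ) (i : Fin 8) :
    homogeneousComponent (t + d) ((A *ᵥ w) i)
      = (A *ᵥ fun j => homogeneousComponent t (w j)) i := by
  simp only [mulVec, dotProduct, map_sum]
  exact Finset.sum_congr rfl fun j _ => hc_mul (hA i j) _ _

theorem isHomogeneous_mulVec {n : ℕ} {A : Matrix (Fin 8) (Fin 8) (MvPolynomial (Fin n) ℂ)} {d : ℕ}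
    (hA : ∀ i j, (A i j).IsHomogeneous d) (w : Fin 8 → MvPolynomial (Fin n) ℂ) (t : ℕ)
    (hw : ∀ i, (w i).IsHomogeneous t) (i : Fin 8) : ((A *ᵥ w) i).IsHomogeneous (t + d) := by
  simp only [mulVec, dotProduct]
  refine IsHomogeneous.sum _ _ _ fun j _ => ?_
  rw [add_comm]
  exact (hA i j).mul (hw j)

theorem lo_hi {n : ℕ} (J : Ideal (MvPolynomial (Fin n) ℂ)) (N : ℕ) (hJ : ∀ i, X i ^ N ∈ J)
    (c : MvPolynomial (Fin n) ℂ) :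
    ∃ lo hi, c = lo + hi ∧ lo.totalDegree ≤ n * N ∧ hi ∈ J := by
  induction c using MvPolynomial.induction_on' with
  | monomial d a =>
    by_cases h : ∃ i, N ≤ d i
    · obtain ⟨i, hi⟩ := h
      refine ⟨0, monomial d a, by simp, by simp, ?_⟩
      have : (monomial d a : MvPolynomial (Fin n) ℂ)
          = monomial (d - Finsupp.single i N) a * X i ^ N := by
        rw [X_pow_eq_monomial, monomial_mul, mul_one, tsub_add_cancel_of_le]
        simpa using hi
      rw [this]
      exact J.mul_mem_left _ (hJ i)
    · push Not at h
      refine ⟨monomial d a, 0, by simp, ?_, J.zero_mem⟩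
      refine (totalDegree_monomial_le d a).trans ?_
      rw [Finsupp.sum_fintype _ _ (fun _ => rfl)]
      calc ∑ i, d i ≤ ∑ _i : Fin n, N := Finset.sum_le_sum fun i _ => (h i).le
        _ = n * N := by simp
  | add p q hp hq =>
    obtain ⟨l1, h1, e1, d1, m1⟩ := hp
    obtain ⟨l2, h2, e2, d2, m2⟩ := hq
    refine ⟨l1 + l2, h1 + h2, by rw [e1, e2]; ring, ?_, J.add_mem m1 m2⟩
    exact (totalDegree_add _ _).trans (max_le d1 d2)

theorem large_degree {n : ℕ} (J : Ideal (MvPolynomial (Fin n) ℂ)) (N : ℕ) (hJ : ∀ i, X i ^ N ∈ J)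
    (Q L : Submodule (MvPolynomial (Fin n) ℂ) (Fin 8 → MvPolynomial (Fin n) ℂ))
    (hJL : ∀ p ∈ J, ∀ v ∈ Q, p • v ∈ L) :
    ∃ T, ∀ t, T ≤ t → ∀ v ∈ Q, (∀ i, (v i).IsHomogeneous t) →
      ∃ u ∈ L, ∀ i, v i = homogeneousComponent t (u i) := by
  obtain ⟨G, hG⟩ := (IsNoetherian.noetherian Q : Q.FG)
  choose lo hi h1 h2 h3 using lo_hi J N hJ
  refine ⟨n * N + (G.sup fun g => Finset.univ.sup fun i => (g i).totalDegree) + 1, ?_⟩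
  intro t ht v hv hvt
  have hv' := hv
  rw [← hG, Submodule.mem_span_finset] at hv'
  obtain ⟨f, -, hf⟩ := hv'
  refine ⟨∑ g ∈ G, hi (f g) • g, L.sum_mem fun g hg => hJL _ (h3 _) _ ?_, ?_⟩
  · rw [← hG]; exact Submodule.subset_span hg
  · intro i
    have e : v i = (∑ g ∈ G, lo (f g) * g i) + (∑ g ∈ G, hi (f g) • g) i := by
      rw [← hf, Finset.sum_apply, Finset.sum_apply, ← Finset.sum_add_distrib]
      refine Finset.sum_congr rfl fun g _ => ?_
      conv_lhs => rw [h1 (f g)]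
      simp [add_mul]
    conv_lhs => rw [← homogeneousComponent_eq_self (hvt i), e]
    rw [map_add, map_sum, Finset.sum_eq_zero, zero_add]
    intro g hg
    apply homogeneousComponent_eq_zero
    have a1 : (g i).totalDegree ≤ Finset.univ.sup fun i => (g i).totalDegree :=
      Finset.le_sup (f := fun i => (g i).totalDegree) (Finset.mem_univ i)
    have a2 := Finset.le_sup (f := fun g : Fin 8 → MvPolynomial (Fin n) ℂ =>
      Finset.univ.sup fun i => (g i).totalDegree) hg
    have a3 := totalDegree_mul (lo (f g)) (g i)
    have a4 := h2 (f g)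
    omega

/-- The matrix of linear forms attached to a family of matrices. -/
noncomputable def linMat {n : ℕ} (B : Fin n → Matrix (Fin 8) (Fin 8) ℂ) :
    Matrix (Fin 8) (Fin 8) (MvPolynomial (Fin n) ℂ) :=
  Matrix.of fun k l => ∑ i, C (B i k l) * X i

/-- Skew families of constant rank six. -/
def Good {n : ℕ} (B : Fin n → Matrix (Fin 8) (Fin 8) ℂ) : Prop :=
  (∀ i, (B i)ᵀ = -(B i)) ∧ ∀ x : Fin n → ℂ, x ≠ 0 → (∑ i, x i • B i).rank = 6

theorem linMat_homog {n : ℕ} (B : Fin n → Matrix (Fin 8) (Fin 8) ℂ) (i j : Fin 8) :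
    (linMat B i j).IsHomogeneous 1 := by
  simp only [linMat, of_apply]
  exact IsHomogeneous.sum _ _ _ fun _ _ => isHomogeneous_C_mul_X _ _

theorem pf6_homog {n : ℕ} {A : Matrix (Fin 8) (Fin 8) (MvPolynomial (Fin n) ℂ)}
    (h : ∀ i j, (A i j).IsHomogeneous 1) (a b c d e f : Fin 8) :
    (pf6 A a b c d e f).IsHomogeneous 3 := by
  have h4 : ∀ a b c d, (pf4 A a b c d).IsHomogeneous 2 := fun a b c d =>
    (((h _ _).mul (h _ _)).sub ((h _ _).mul (h _ _))).add ((h _ _).mul (h _ _))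
  exact (((((h _ _).mul (h4 _ _ _ _)).sub ((h _ _).mul (h4 _ _ _ _))).add
    ((h _ _).mul (h4 _ _ _ _))).sub ((h _ _).mul (h4 _ _ _ _))).add ((h _ _).mul (h4 _ _ _ _))

theorem pfAdj_homog {n : ℕ} {A : Matrix (Fin 8) (Fin 8) (MvPolynomial (Fin n) ℂ)}
    (h : ∀ i j, (A i j).IsHomogeneous 1) (i j : Fin 8) : (pfAdj A i j).IsHomogeneous 3 := by
  have h6 := pf6_homog h
  have h6' := fun a b c d e f => (pf6_homog h a b c d e f).neg
  have h0 := isHomogeneous_zero (Fin n) ℂ 3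
  fin_cases i <;> fin_cases j <;> simp [pfAdj, h6, h6', h0]

theorem linMat_transpose {n : ℕ} {B : Fin n → Matrix (Fin 8) (Fin 8) ℂ} (h : Good B) :
    (linMat B)ᵀ = -linMat B := by
  refine Matrix.ext fun i j => ?_
  have : ∀ k, B k j i = - B k i j := fun k => congrFun (congrFun (h.1 k) i) j
  simp [linMat, this]

theorem linMat_diag {n : ℕ} {B : Fin n → Matrix (Fin 8) (Fin 8) ℂ} (h : Good B) (i : Fin 8) :
    linMat B i i = 0 := by
  have : ∀ k, B k i i = 0 := fun k => by
    have := congrFun (congrFun (h.1 k) i) i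
    simp only [transpose_apply, Matrix.neg_apply] at this
    linear_combination (1 / 2 : ℂ) * this
  simp [linMat, this]

theorem linMat_eval {n : ℕ} (B : Fin n → Matrix (Fin 8) (Fin 8) ℂ) (x : Fin n → ℂ) :
    (linMat B).map (eval x) = ∑ i, x i • B i := by
  refine Matrix.ext fun i j => ?_
  simp [linMat, Matrix.sum_apply, mul_comm]

theorem linMat_pf8 {n : ℕ} {B : Fin n → Matrix (Fin 8) (Fin 8) ℂ} (h : Good B) :
    pf8 (linMat B) = 0 := by
  apply MvPolynomial.funext
  intro x
  rw [map_zero]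
  by_contra hne
  have hs := linMat_transpose h
  have h1 := mul_pfAdj_row (linMat B) (fun i j _ => congrFun (congrFun hs j) i) (linMat_diag h)
  have h2 : (linMat B).map (eval x) * (pfAdj (linMat B)).map (eval x)
      = eval x (pf8 (linMat B)) • (1 : Matrix (Fin 8) (Fin 8) ℂ) := by
    rw [← Matrix.map_mul, h1]
    refine Matrix.ext fun i j => ?_
    by_cases hij : i = j
    · simp [hij]
    · simp [hij]
  rw [linMat_eval] at h2
  have h3 : (∑ i, x i • B i) * ((eval x (pf8 (linMat B)))⁻¹ • (pfAdj (linMat B)).map (eval x))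
      = 1 := by
    rw [Matrix.mul_smul, h2, smul_smul, inv_mul_cancel₀ hne, one_smul]
  have h4 : (∑ i, x i • B i).rank = 8 := by
    have := Matrix.rank_of_isUnit _ (IsUnit.of_mul_eq_one _ h3)
    simpa using this
  by_cases hx : x = 0
  · subst hx
    simp at h4
  · rw [h.2 x hx] at h4
    omega

theorem linMat_mul {n : ℕ} {B : Fin n → Matrix (Fin 8) (Fin 8) ℂ} (h : Good B) :
    linMat B * pfAdj (linMat B) = 0 := by
  have hs := linMat_transpose h
  rw [mul_pfAdj_row (linMat B) (fun i j _ => congrFun (congrFun hs j) i) (linMat_diag h),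
    linMat_pf8 h, zero_smul]

theorem linMat_mul' {n : ℕ} {B : Fin n → Matrix (Fin 8) (Fin 8) ℂ} (h : Good B) :
    pfAdj (linMat B) * linMat B = 0 := by
  have := congrArg transpose (linMat_mul h)
  simpa [transpose_mul, linMat_transpose h, pfAdj_transpose] using this

/-- The ideal of sub-Pfaffians. -/
noncomputable def pfIdeal {n : ℕ} (B : Fin n → Matrix (Fin 8) (Fin 8) ℂ) :
    Ideal (MvPolynomial (Fin n) ℂ) :=
  Ideal.span {p | ∃ i j, i < j ∧ p = pfAdj (linMat B) j i}

theorem pfIdeal_pow {n : ℕ} {B : Fin n → Matrix (Fin 8) (Fin 8) ℂ} (h : Good B) :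
    ∃ N, ∀ i, X i ^ N ∈ pfIdeal B := by
  have hrad : ∀ i, X i ∈ (pfIdeal B).radical := by
    intro i
    rw [← vanishingIdeal_zeroLocus_eq_radical (K := ℂ)]
    intro x hx
    by_cases hx0 : x = 0
    · simp [hx0]
    exfalso
    have hz : ∀ i j, i < j → pfAdj (∑ i, x i • B i) j i = 0 := by
      intro i j hij
      rw [← linMat_eval, ← map_pfAdj (eval x)]
      exact hx _ (Ideal.subset_span ⟨i, j, hij, rfl⟩)
    have hsk := fun i j => congrFun (congrFun (pfAdj_transpose (∑ i, x i • B i)) i) j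
    simp only [transpose_apply, Matrix.neg_apply] at hsk
    have hz' : ∀ i j, pfAdj (∑ i, x i • B i) i j = 0 := by
      intro i j
      rcases lt_trichotomy i j with hij | hij | hij
      · rw [hsk j i, hz i j hij, neg_zero]
      · subst hij
        have := hsk i i
        linear_combination (1 / 2 : ℂ) * this
      · exact hz j i hij
    have hr := rank_le_four (∑ i, x i • B i) (fun i j => by
      have : ∀ k, B k i j = - B k j i := fun k => congrFun (congrFun (h.1 k) j) i
      simp [Matrix.sum_apply, this]) hz'
    rw [h.2 x hx0] at hr
    omega
  choose N hN using hrad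
  refine ⟨Finset.univ.sup N, fun i => ?_⟩
  exact Ideal.pow_mem_of_pow_mem _ (hN i) (Finset.le_sup (Finset.mem_univ i))

theorem exact_gen {n : ℕ} {B : Fin n → Matrix (Fin 8) (Fin 8) ℂ} (h : Good B)
    (M1 M2 : Matrix (Fin 8) (Fin 8) (MvPolynomial (Fin n) ℂ)) (d : ℕ)
    (hM : ∀ i j, (M2 i j).IsHomogeneous d)
    (hk : ∀ i j, i < j → ∃ Y Z, Y * M1 + M2 * Z
      = pfAdj (linMat B) j i • (1 : Matrix (Fin 8) (Fin 8) (MvPolynomial (Fin n) ℂ))) :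
    ∃ T, ∀ t, T ≤ t → ∀ v : Fin 8 → MvPolynomial (Fin n) ℂ, (∀ i, (v i).IsHomogeneous (t + d)) →
      M1 *ᵥ v = 0 → ∃ w : Fin 8 → MvPolynomial (Fin n) ℂ, (∀ i, (w i).IsHomogeneous t) ∧
        M2 *ᵥ w = v := by
  obtain ⟨N, hN⟩ := pfIdeal_pow h
  obtain ⟨T, hT⟩ := large_degree (pfIdeal B) N hN (LinearMap.ker M1.mulVecLin)
    (LinearMap.range M2.mulVecLin) (by
      intro p hp v hv
      have hv : M1 *ᵥ v = 0 := hv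
      induction hp using Submodule.span_induction with
      | mem x hx =>
        obtain ⟨i, j, hij, rfl⟩ := hx
        obtain ⟨Y, Z, e⟩ := hk i j hij
        refine ⟨Z *ᵥ v, ?_⟩
        have := congrArg (fun M => M *ᵥ v) e
        simp only [add_mulVec, ← mulVec_mulVec, hv, mulVec_zero, zero_add, smul_mulVec,
          one_mulVec] at this
        simpa using this
      | zero => simp
      | add x y _ _ hx hy => rw [add_smul]; exact Submodule.add_mem _ hx hy
      | smul a x _ hx =>
        rw [smul_eq_mul, mul_smul]; exact Submodule.smul_mem _ _ hx)
  refine ⟨T, fun t ht v hv h0 => ?_⟩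
  obtain ⟨u, ⟨w, rfl⟩, hu⟩ := hT (t + d) (by omega) v h0 hv
  refine ⟨fun j => homogeneousComponent t (w j), fun i => homogeneousComponent_isHomogeneous _ _,
    ?_⟩
  funext i
  rw [hu i, mulVecLin_apply, hc_mulVec hM]

theorem exact1 {n : ℕ} {B : Fin n → Matrix (Fin 8) (Fin 8) ℂ} (h : Good B) :
    ∃ T, ∀ t, T ≤ t → ∀ v : Fin 8 → MvPolynomial (Fin n) ℂ, (∀ i, (v i).IsHomogeneous (t + 3)) →
      linMat B *ᵥ v = 0 → ∃ w : Fin 8 → MvPolynomial (Fin n) ℂ, (∀ i, (w i).IsHomogeneous t) ∧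
        pfAdj (linMat B) *ᵥ w = v :=
  exact_gen h _ _ 3 (pfAdj_homog (linMat_homog B)) fun i j hij =>
    ⟨_, _, homotopy2 (linMat B) (linMat_transpose h) (linMat_diag h) i j hij⟩

theorem exact2 {n : ℕ} {B : Fin n → Matrix (Fin 8) (Fin 8) ℂ} (h : Good B) :
    ∃ T, ∀ t, T ≤ t → ∀ v : Fin 8 → MvPolynomial (Fin n) ℂ, (∀ i, (v i).IsHomogeneous (t + 1)) →
      pfAdj (linMat B) *ᵥ v = 0 → ∃ w : Fin 8 → MvPolynomial (Fin n) ℂ,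
        (∀ i, (w i).IsHomogeneous t) ∧ linMat B *ᵥ w = v :=
  exact_gen h _ _ 1 (linMat_homog B) fun i j hij =>
    ⟨_, _, (add_comm _ _).trans
      (homotopy1 (linMat B) (linMat_transpose h) (linMat_diag h) i j hij)⟩

end Graded
section Counting

open MvPolynomial

/-- The degree `t` part of the kernel of a matrix. -/
noncomputable def Kt {n : ℕ} (A : Matrix (Fin 8) (Fin 8) (MvPolynomial (Fin n) ℂ)) (t : ℕ) :
    Submodule ℂ (Fin 8 → MvPolynomial (Fin n) ℂ) :=
  Submodule.pi Set.univ (fun _ => homogeneousSubmodule (Fin n) ℂ t) ⊓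
    LinearMap.ker (A.mulVecLin.restrictScalars ℂ)

theorem mem_Kt {n : ℕ} {A : Matrix (Fin 8) (Fin 8) (MvPolynomial (Fin n) ℂ)} {t : ℕ}
    {v : Fin 8 → MvPolynomial (Fin n) ℂ} :
    v ∈ Kt A t ↔ (∀ i, (v i).IsHomogeneous t) ∧ A *ᵥ v = 0 := by
  simp [Kt, Submodule.mem_pi]

instance Kt_finite {n : ℕ} (A : Matrix (Fin 8) (Fin 8) (MvPolynomial (Fin n) ℂ)) (t : ℕ) :
    FiniteDimensional ℂ (Kt A t) := by
  have : FiniteDimensional ℂ (Submodule.pi (Set.univ : Set (Fin 8))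
      (fun _ => homogeneousSubmodule (Fin n) ℂ t)) :=
    Module.Finite.iff_fg.mpr (Submodule.fg_pi fun _ => homogeneousSubmodule_fg _ _ t)
  exact Submodule.finiteDimensional_of_le inf_le_left

theorem rank_nullity_sub {V W : Type*} [AddCommGroup V] [Module ℂ V] [AddCommGroup W] [Module ℂ W]
    (f : V →ₗ[ℂ] W) (p : Submodule ℂ V) [FiniteDimensional ℂ p] (q : Submodule ℂ V)
    (r : Submodule ℂ W) (hq : ∀ v, v ∈ q ↔ v ∈ p ∧ f v = 0) (hr : ∀ w, w ∈ r ↔ ∃ v ∈ p, f v = w) :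
    Module.finrank ℂ r + Module.finrank ℂ q = Module.finrank ℂ p := by
  have h := LinearMap.finrank_range_add_finrank_ker (f.comp p.subtype)
  have h1 : LinearMap.range (f.comp p.subtype) = r := by
    ext w
    rw [hr]
    simp
  have h2 : (LinearMap.ker (f.comp p.subtype)).map p.subtype = q := by
    ext v
    rw [hq]
    simp [and_comm]
  rw [← h1, ← h2, Submodule.finrank_map_subtype_eq]
  exact h

/-- Ambient dimension. -/
noncomputable def vd (n t : ℕ) : ℕ :=
  Module.finrank ℂ (Kt (0 : Matrix (Fin 8) (Fin 8) (MvPolynomial (Fin n) ℂ)) t)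

theorem periodic {n : ℕ} {B : Fin n → Matrix (Fin 8) (Fin 8) ℂ} (h : Good B) :
    ∃ T, ∀ t, T ≤ t → Module.finrank ℂ (Kt (linMat B) (t + 4)) + vd n t
      = vd n (t + 1) + Module.finrank ℂ (Kt (linMat B) t) := by
  obtain ⟨T1, h1⟩ := exact1 h
  obtain ⟨T2, h2⟩ := exact2 h
  refine ⟨max T1 T2, fun t ht => ?_⟩
  have a := rank_nullity_sub ((pfAdj (linMat B)).mulVecLin.restrictScalars ℂ)
    (Kt (0 : Matrix (Fin 8) (Fin 8) (MvPolynomial (Fin n) ℂ)) (t + 1))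
    (Kt (pfAdj (linMat B)) (t + 1)) (Kt (linMat B) (t + 4))
    (by intro v; simp [mem_Kt])
    (by
      intro w
      simp only [mem_Kt, zero_mulVec, and_true, LinearMap.restrictScalars_apply, mulVecLin_apply]
      constructor
      · rintro ⟨hw, hw'⟩
        exact h1 (t + 1) (by have := le_max_left T1 T2; omega) w hw hw'
      · rintro ⟨v, hv, rfl⟩
        refine ⟨isHomogeneous_mulVec (pfAdj_homog (linMat_homog B)) v (t + 1) hv, ?_⟩
        rw [mulVec_mulVec, linMat_mul h, zero_mulVec])
  have b := rank_nullity_sub ((linMat B).mulVecLin.restrictScalars ℂ)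
    (Kt (0 : Matrix (Fin 8) (Fin 8) (MvPolynomial (Fin n) ℂ)) t)
    (Kt (linMat B) t) (Kt (pfAdj (linMat B)) (t + 1))
    (by intro v; simp [mem_Kt])
    (by
      intro w
      simp only [mem_Kt, zero_mulVec, and_true, LinearMap.restrictScalars_apply, mulVecLin_apply]
      constructor
      · rintro ⟨hw, hw'⟩
        exact h2 t (by have := le_max_right T1 T2; omega) w hw hw'
      · rintro ⟨v, hv, rfl⟩
        refine ⟨isHomogeneous_mulVec (linMat_homog B) v t hv, ?_⟩
        rw [mulVec_mulVec, linMat_mul' h, zero_mulVec])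
  unfold vd
  omega

/-- Restriction to the hyperplane where the first variable vanishes. -/
noncomputable def res (n : ℕ) : MvPolynomial (Fin (n + 1)) ℂ →ₐ[ℂ] MvPolynomial (Fin n) ℂ :=
  aeval (Fin.cons 0 X)

theorem res_rename {n : ℕ} (p : MvPolynomial (Fin n) ℂ) : res n (rename Fin.succ p) = p := by
  rw [res, aeval_rename]
  have : (Fin.cons 0 X : Fin (n + 1) → MvPolynomial (Fin n) ℂ) ∘ Fin.succ = X := by
    funext i; simp
  rw [this, aeval_X_left_apply]

theorem res_decomp {n : ℕ} (p : MvPolynomial (Fin (n + 1)) ℂ) :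
    ∃ q, p = rename Fin.succ (res n p) + X 0 * q := by
  induction p using MvPolynomial.induction_on with
  | C a => exact ⟨0, by simp [res]⟩
  | add p q hp hq =>
    obtain ⟨a, ha⟩ := hp
    obtain ⟨b, hb⟩ := hq
    refine ⟨a + b, ?_⟩
    rw [map_add, map_add]
    linear_combination ha + hb
  | mul_X p i hp =>
    obtain ⟨a, ha⟩ := hp
    refine Fin.cases ?_ (fun j => ?_) i
    · refine ⟨p, ?_⟩
      simp [res, mul_comm]
    · refine ⟨a * X j.succ, ?_⟩
      have : rename Fin.succ (res n (X j.succ)) = (X j.succ : MvPolynomial (Fin (n + 1)) ℂ) := by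
        simp [res]
      rw [map_mul, map_mul, this]
      linear_combination X j.succ * ha

theorem res_homog {n t : ℕ} {p : MvPolynomial (Fin (n + 1)) ℂ} (hp : p.IsHomogeneous t) :
    (res n p).IsHomogeneous t := by
  have := hp.aeval (n := 1) (Fin.cons 0 X : Fin (n + 1) → MvPolynomial (Fin n) ℂ) (by
    intro i
    refine Fin.cases ?_ (fun j => ?_) i
    · simpa using isHomogeneous_zero _ _ _
    · simpa using isHomogeneous_X _ _)
  simpa [res] using this

theorem res_ker {n t : ℕ} {p : MvPolynomial (Fin (n + 1)) ℂ} (hp : p.IsHomogeneous (t + 1))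
    (h : res n p = 0) : ∃ q, q.IsHomogeneous t ∧ p = X 0 * q := by
  obtain ⟨q, hq⟩ := res_decomp p
  rw [h, map_zero, zero_add] at hq
  refine ⟨homogeneousComponent t q, homogeneousComponent_isHomogeneous _ _, ?_⟩
  rw [← hc_mul (isHomogeneous_X ℂ 0), ← hq, homogeneousComponent_eq_self hp]

theorem res_mulVec {n : ℕ} (A : Matrix (Fin 8) (Fin 8) (MvPolynomial (Fin (n + 1)) ℂ))
    (v : Fin 8 → MvPolynomial (Fin (n + 1)) ℂ) :
    (fun i => res n ((A *ᵥ v) i)) = A.map (res n) *ᵥ fun i => res n (v i) := by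
  funext i
  simp [mulVec, dotProduct]

theorem restrict_count {n t : ℕ} (A : Matrix (Fin 8) (Fin 8) (MvPolynomial (Fin (n + 1)) ℂ))
    (hlift : ∀ v ∈ Kt (A.map (res n)) (t + 1), ∃ w ∈ Kt A (t + 1), (fun i => res n (w i)) = v) :
    Module.finrank ℂ (Kt A (t + 1))
      = Module.finrank ℂ (Kt A t) + Module.finrank ℂ (Kt (A.map (res n)) (t + 1)) := by
  let f : (Fin 8 → MvPolynomial (Fin (n + 1)) ℂ) →ₗ[ℂ] (Fin 8 → MvPolynomial (Fin n) ℂ) :=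
    (res n).toLinearMap.compLeft (Fin 8)
  have hf : ∀ v, f v = fun i => res n (v i) := fun v => rfl
  let g : (Fin 8 → MvPolynomial (Fin (n + 1)) ℂ) →ₗ[ℂ] (Fin 8 → MvPolynomial (Fin (n + 1)) ℂ) :=
    (LinearMap.mulLeft ℂ (X 0)).compLeft (Fin 8)
  have hg : ∀ v, g v = (X 0 : MvPolynomial (Fin (n + 1)) ℂ) • v := fun v => rfl
  have ginj : ∀ v, g v = 0 ↔ v = 0 := by
    intro v
    rw [hg, smul_eq_zero]
    simp [X_ne_zero]
  have a := rank_nullity_sub f (Kt A (t + 1)) ((Kt A t).map g) (Kt (A.map (res n)) (t + 1))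
    (by
      intro v
      constructor
      · rintro ⟨w, hw, rfl⟩
        rw [SetLike.mem_coe, mem_Kt] at hw
        refine ⟨mem_Kt.2 ⟨fun i => ?_, ?_⟩, ?_⟩
        · rw [hg, add_comm t 1]
          exact (isHomogeneous_X ℂ (0 : Fin (n + 1))).mul (hw.1 i)
        · rw [hg, mulVec_smul, hw.2, smul_zero]
        · rw [hg, hf]
          funext i
          simp [res]
      · rintro ⟨hv, hv0⟩
        rw [mem_Kt] at hv
        have : ∀ i, ∃ q : MvPolynomial (Fin (n + 1)) ℂ, q.IsHomogeneous t ∧ v i = X 0 * q :=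
          fun i => res_ker (hv.1 i) (congrFun hv0 i)
        choose q hq1 hq2 using this
        have hvq : v = g q := funext hq2
        refine ⟨q, mem_Kt.2 ⟨hq1, ?_⟩, hvq.symm⟩
        have h2 := hv.2
        rw [hvq, hg, mulVec_smul, ← hg, ginj] at h2
        exact h2)
    (by
      intro w
      constructor
      · intro hw
        exact hlift w hw
      · rintro ⟨v, hv, rfl⟩
        rw [mem_Kt] at hv
        rw [hf]
        refine mem_Kt.2 ⟨fun i => res_homog (hv.1 i), ?_⟩
        rw [← res_mulVec, hv.2]
        funext i
        simp)
  have b := rank_nullity_sub g (Kt A t) ⊥ ((Kt A t).map g)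
    (by
      intro v
      rw [ginj, Submodule.mem_bot]
      constructor
      · rintro rfl; exact ⟨Submodule.zero_mem _, rfl⟩
      · exact fun h => h.2)
    (fun w => Submodule.mem_map)
  rw [finrank_bot] at b
  omega

theorem vd_succ (n t : ℕ) : vd (n + 1) (t + 1) = vd (n + 1) t + vd n (t + 1) := by
  have h0 : (0 : Matrix (Fin 8) (Fin 8) (MvPolynomial (Fin (n + 1)) ℂ)).map (res n) = 0 := by
    refine Matrix.ext fun i j => ?_
    simp
  have := restrict_count (n := n) (t := t) 0 (by
    rw [h0]
    intro v hv
    rw [mem_Kt] at hv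
    refine ⟨fun i => rename Fin.succ (v i), mem_Kt.2 ⟨fun i => (hv.1 i).rename_isHomogeneous, ?_⟩,
      ?_⟩
    · simp
    · funext i; exact res_rename _)
  rw [h0] at this
  exact this

theorem Kt_zero_var (t : ℕ) (A : Matrix (Fin 8) (Fin 8) (MvPolynomial (Fin 0) ℂ)) :
    Module.finrank ℂ (Kt A (t + 1)) = 0 := by
  have : Kt A (t + 1) = ⊥ := by
    rw [eq_bot_iff]
    intro v hv
    rw [mem_Kt] at hv
    rw [Submodule.mem_bot]
    funext i
    by_contra hne
    have := (hv.1 i).inj_right (isHomogeneous_of_isEmpty _ _ (v i)) hne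
    omega
  rw [this, finrank_bot]

theorem vd_zero (n : ℕ) : vd n 0 = 8 := by
  let c : (Fin 8 → ℂ) →ₗ[ℂ] (Fin 8 → MvPolynomial (Fin n) ℂ) :=
    (Algebra.linearMap ℂ (MvPolynomial (Fin n) ℂ)).compLeft (Fin 8)
  have hc : ∀ v, c v = fun i => C (v i) := fun v => rfl
  have := rank_nullity_sub c ⊤ ⊥ (Kt (0 : Matrix (Fin 8) (Fin 8) (MvPolynomial (Fin n) ℂ)) 0)
    (by
      intro v
      simp only [Submodule.mem_bot, Submodule.mem_top, true_and, hc]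
      constructor
      · rintro rfl; funext i; simp
      · intro h; funext i; simpa using congrFun h i)
    (by
      intro w
      simp only [mem_Kt, zero_mulVec, and_true, Submodule.mem_top, true_and, hc]
      constructor
      · intro hw
        refine ⟨fun i => coeff 0 (w i), ?_⟩
        funext i
        exact (totalDegree_eq_zero_iff_eq_C.1 ((totalDegree_zero_iff_isHomogeneous _).2 (hw i))).symm
      · rintro ⟨v, rfl⟩ i
        exact isHomogeneous_C _ _)
  rw [finrank_bot, finrank_top] at this
  simpa [vd] using this

theorem vd_one (t : ℕ) : vd 1 t = 8 := by
  induction t with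
  | zero => exact vd_zero 1
  | succ t ih => rw [vd_succ, ih, vd, Kt_zero_var]

theorem vd_two (t : ℕ) : vd 2 t = 8 * (t + 1) := by
  induction t with
  | zero => exact vd_zero 2
  | succ t ih => rw [vd_succ, ih, vd_one]; ring

theorem vd_three (t : ℕ) : vd 3 t = 4 * ((t + 1) * (t + 2)) := by
  induction t with
  | zero => exact vd_zero 3
  | succ t ih => rw [vd_succ, ih, vd_two]; ring

theorem good_succ {n : ℕ} {B : Fin (n + 1) → Matrix (Fin 8) (Fin 8) ℂ} (h : Good B) :
    Good (fun i => B (Fin.succ i)) := by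
  refine ⟨fun i => h.1 _, fun x hx => ?_⟩
  have := h.2 (Fin.cons 0 x) (by
    intro h0
    apply hx
    funext i
    simpa using congrFun h0 i.succ)
  simpa [Fin.sum_univ_succ] using this

theorem linMat_res {n : ℕ} (B : Fin (n + 1) → Matrix (Fin 8) (Fin 8) ℂ) :
    (linMat B).map (res n) = linMat (fun i => B (Fin.succ i)) := by
  refine Matrix.ext fun i j => ?_
  simp [linMat, res, Fin.sum_univ_succ]

theorem kd_succ {n : ℕ} {B : Fin (n + 1) → Matrix (Fin 8) (Fin 8) ℂ} (h : Good B) :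
    ∃ T, ∀ t, T ≤ t → Module.finrank ℂ (Kt (linMat B) (t + 1))
      = Module.finrank ℂ (Kt (linMat B) t)
        + Module.finrank ℂ (Kt (linMat fun i => B (Fin.succ i)) (t + 1)) := by
  obtain ⟨T, hT⟩ := exact1 (good_succ h)
  refine ⟨T + 2, fun t ht => ?_⟩
  rw [← linMat_res]
  apply restrict_count
  rw [linMat_res]
  intro v hv
  rw [mem_Kt] at hv
  obtain ⟨s, rfl⟩ : ∃ s, t = s + 2 := ⟨t - 2, by omega⟩
  obtain ⟨w, hw, rfl⟩ := hT s (by omega) v hv.1 hv.2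
  refine ⟨pfAdj (linMat B) *ᵥ fun i => rename Fin.succ (w i), mem_Kt.2 ⟨?_, ?_⟩, ?_⟩
  · exact isHomogeneous_mulVec (pfAdj_homog (linMat_homog B)) _ s
      fun i => (hw i).rename_isHomogeneous
  · rw [mulVec_mulVec, linMat_mul h, zero_mulVec]
  · rw [res_mulVec]
    have e1 : (pfAdj (linMat B)).map (res n) = pfAdj (linMat fun i => B (Fin.succ i)) := by
      refine Matrix.ext fun i j => ?_
      rw [← linMat_res]
      exact map_pfAdj (res n).toRingHom (linMat B) i j
    rw [e1]
    simp only [res_rename]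

theorem no_good_four (B : Fin 4 → Matrix (Fin 8) (Fin 8) ℂ) (h4 : Good B) : False := by
  have h3 := good_succ h4
  have h2 := good_succ h3
  have h1 := good_succ h2
  obtain ⟨T4, d4⟩ := kd_succ h4
  obtain ⟨T3, d3⟩ := kd_succ h3
  obtain ⟨T2, d2⟩ := kd_succ h2
  obtain ⟨T1, d1⟩ := kd_succ h1
  obtain ⟨S4, p4⟩ := periodic h4
  obtain ⟨S3, p3⟩ := periodic h3
  obtain ⟨S2, p2⟩ := periodic h2
  simp only [Kt_zero_var, add_zero] at d1
  obtain ⟨k4, f4⟩ : ∃ k : ℕ → ℕ, ∀ t,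
      Module.finrank ℂ (Kt (linMat (B)) t) = k t := ⟨_, fun _ => rfl⟩
  obtain ⟨k3, f3⟩ : ∃ k : ℕ → ℕ, ∀ t,
      Module.finrank ℂ (Kt (linMat (fun i => B (Fin.succ i))) t) = k t := ⟨_, fun _ => rfl⟩
  obtain ⟨k2, f2⟩ : ∃ k : ℕ → ℕ, ∀ t,
      Module.finrank ℂ (Kt (linMat (fun i => B (Fin.succ (Fin.succ i)))) t) = k t := ⟨_, fun _ => rfl⟩
  obtain ⟨k1, f1⟩ : ∃ k : ℕ → ℕ, ∀ t,
      Module.finrank ℂ (Kt (linMat (fun i => B (Fin.succ (Fin.succ (Fin.succ i))))) t) = k t := ⟨_, fun _ => rfl⟩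
  simp only [f4, f3, f2, f1] at d4 d3 d2 d1 p4 p3 p2
  obtain ⟨T, hT⟩ : ∃ T, T = T1 + T2 + T3 + T4 + S2 + S3 + S4 := ⟨_, rfl⟩
  have q4 := p4 T (by omega)
  have q3 := p3 T (by omega)
  have q3' := p3 (T + 1) (by omega)
  have q2 := p2 T (by omega)
  rw [vd_succ, vd_three] at q4
  rw [vd_succ, vd_two] at q3
  rw [vd_succ, vd_one] at q2
  rw [vd_succ 2, vd_two] at q3'
  have a0 := d4 T (by omega)
  have a1 := d4 (T + 1) (by omega)
  have a2 := d4 (T + 2) (by omega)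
  have a3 := d4 (T + 3) (by omega)
  have b0 := d3 T (by omega)
  have b1 := d3 (T + 1) (by omega)
  have b2 := d3 (T + 2) (by omega)
  have b3 := d3 (T + 3) (by omega)
  have c0 := d2 T (by omega)
  have c1 := d2 (T + 1) (by omega)
  have c2 := d2 (T + 2) (by omega)
  have c3 := d2 (T + 3) (by omega)
  have e0 := d1 T (by omega)
  have e1 := d1 (T + 1) (by omega)
  have e2 := d1 (T + 2) (by omega)
  have e3 := d1 (T + 3) (by omega)
  generalize (T + 1 + 1) * (T + 1 + 2) = N at q4
  simp only [add_assoc, Nat.reduceAdd] at *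
  omega

end Counting

/-- There is no 4-dimensional space of skew-symmetric `8×8` complex
matrices of constant rank 6. -/
theorem stmt_14 :
    ¬ ∃ M : Submodule ℂ (Matrix (Fin 8) (Fin 8) ℂ),
      Module.finrank ℂ M = 4 ∧ (∀ A ∈ M, Aᵀ = -A) ∧ (∀ A ∈ M, A ≠ 0 → A.rank = 6) := by
  rintro ⟨M, hM, hs, hr⟩
  let b := Module.finBasisOfFinrankEq ℂ M hM
  refine no_good_four (fun i => (b i : Matrix (Fin 8) (Fin 8) ℂ)) ⟨fun i => hs _ (b i).2, ?_⟩
  intro x hx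
  have e : (∑ i, x i • (b i : Matrix (Fin 8) (Fin 8) ℂ)) = ((∑ i, x i • b i : M) : Matrix _ _ ℂ) := by
    simp
  rw [e]
  refine hr _ (Subtype.mem _) fun h0 => hx ?_
  have h0' : ∑ i, x i • b i = 0 := Subtype.ext h0
  funext i
  exact Fintype.linearIndependent_iff.1 b.linearIndependent x h0' i
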